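/- There exist absolute constants c > 0 and C > 0 such that the following holds. Let A ⊆ {1, …, N} have density α = |A|/N and contain no nontrivial three-term arithmetic progression. Then either N < 8/α², or there exist an integer m with 1 ≤ m ≤ C·α^{−9}, integers a, q ≥ 1, and N' ≥ c·α·N^{1/(m+1)} such that the arithmetic progression P = {a + q, a + 2q, …, a + N'q} satisfies P ⊆ {1, …, N} and |A ∩ P|/|P| ≥ α·(1 + c·m^{1/9}). -/

import Mathlib

open Finset

/-- The exponential sum `∑ z, F z * e(z r / M)` of a real function on `ℤ/Mℤ`. -/
noncomputable def charSum {M : ℕ} [NeZero M] (F : ZMod M → ℝ) (r : ZMod M) : ℂ :=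
  ∑ z, (F z : ℂ) * ZMod.stdAddChar (z * r)

/-- The weighted count of solutions to `x + y = 2 z`. -/
noncomputable def tripleSum {M : ℕ} [NeZero M] (F : ZMod M → ℝ) : ℝ :=
  ∑ x, ∑ y, ∑ z, if x + y = 2 * z then F x * F y * F z else 0

section charSum

variable {M : ℕ} [NeZero M]

theorem charSum_add (F G : ZMod M → ℝ) (r : ZMod M) :
    charSum (F + G) r = charSum F r + charSum G r := by
  simp [charSum, add_mul, sum_add_distrib]

theorem charSum_const_mul (a : ℝ) (F : ZMod M → ℝ) (r : ZMod M) :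
    charSum (fun z => a * F z) r = a * charSum F r := by
  simp [charSum, mul_sum, mul_assoc]

theorem norm_charSum_le (F : ZMod M → ℝ) (r : ZMod M) : ‖charSum F r‖ ≤ ∑ z, |F z| := by
  refine (norm_sum_le _ _).trans_eq (sum_congr rfl fun z _ => ?_)
  rw [norm_mul, ZMod.stdAddChar_apply, Circle.norm_coe, mul_one, Complex.norm_real, Real.norm_eq_abs]

theorem sum_norm_charSum_sq (F : ZMod M → ℝ) :
    ∑ r, ‖charSum F r‖ ^ 2 = M * ∑ z, F z ^ 2 := by
  have h (r : ZMod M) : ((‖charSum F r‖ ^ 2 : ℝ) : ℂ) =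
      ∑ z, ∑ w, (F z * F w : ℂ) * ZMod.stdAddChar (r * (z - w)) := by
    rw [Complex.ofReal_pow, ← Complex.mul_conj', charSum, map_sum, sum_mul_sum]
    refine sum_congr rfl fun z _ => sum_congr rfl fun w _ => ?_
    rw [map_mul (starRingEnd ℂ), Complex.conj_ofReal, ← AddChar.map_neg_eq_conj,
      show r * (z - w) = z * r + -(w * r) by ring, AddChar.map_add_eq_mul]
    ring
  rw [← Complex.ofReal_inj, Complex.ofReal_sum]
  simp_rw [h]
  rw [sum_comm]
  rw [Complex.ofReal_mul, Complex.ofReal_sum, mul_sum]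
  refine sum_congr rfl fun z _ => ?_
  rw [sum_comm]
  simp_rw [← mul_sum, AddChar.sum_mulShift _ (ZMod.isPrimitive_stdAddChar M), sub_eq_zero,
    ZMod.card]
  simp
  ring

theorem sum_charSum_mul_mul (F : ZMod M → ℝ) :
    ∑ r, charSum F r * charSum F r * charSum F (-2 * r) =
      ((M * tripleSum F : ℝ) : ℂ) := by
  have h (r : ZMod M) : charSum F r * charSum F r * charSum F (-2 * r) =
      ∑ x, ∑ y, ∑ z, (F x * F y * F z : ℂ) * ZMod.stdAddChar (r * (x + y - 2 * z)) := by
    rw [charSum, charSum, sum_mul_sum, sum_mul]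
    refine sum_congr rfl fun x _ => ?_
    rw [sum_mul]
    refine sum_congr rfl fun y _ => ?_
    rw [mul_sum]
    refine sum_congr rfl fun z _ => ?_
    rw [show r * (x + y - 2 * z) = x * r + y * r + z * (-2 * r) by ring,
      AddChar.map_add_eq_mul, AddChar.map_add_eq_mul]
    ring
  simp_rw [h, tripleSum]
  push_cast
  rw [sum_comm, mul_sum]
  refine sum_congr rfl fun x _ => ?_
  rw [sum_comm, mul_sum]
  refine sum_congr rfl fun y _ => ?_
  rw [sum_comm, mul_sum]
  refine sum_congr rfl fun z _ => ?_
  rw [← mul_sum, AddChar.sum_mulShift _ (ZMod.isPrimitive_stdAddChar M), ZMod.card]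
  simp only [sub_eq_zero]
  split_ifs <;> simp [mul_comm]

theorem charSum_sum_shift (F : ZMod M → ℝ) (n : ℕ) (q r : ZMod M) :
    charSum (fun x => ∑ i ∈ range n, F (x + (i : ZMod M) * q)) r =
      (∑ i ∈ range n, ZMod.stdAddChar (-((i : ZMod M) * q * r))) * charSum F r := by
  simp only [charSum, Complex.ofReal_sum, sum_mul]
  rw [sum_comm]
  refine sum_congr rfl fun i _ => ?_
  rw [mul_sum, ← Equiv.sum_comp (Equiv.addRight (-((i : ZMod M) * q)))]
  refine sum_congr rfl fun z _ => ?_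
  simp only [Equiv.coe_addRight, neg_add_cancel_right]
  rw [show (z + -((i : ZMod M) * q)) * r = -((i : ZMod M) * q * r) + z * r by ring,
    AddChar.map_add_eq_mul]
  ring

theorem half_le_norm_sum_stdAddChar {n q Q : ℕ} {r : ZMod M} (hn : 8 * (n - 1) ≤ Q) (hQ : 0 < Q)
    {k : ℤ} (hk : |q * (r.val / M : ℝ) - k| ≤ 1 / Q) :
    (n / 2 : ℝ) ≤ ‖∑ i ∈ range n, ZMod.stdAddChar (-(i * q * r) : ZMod M)‖ := by
  refine le_trans ?_ (Complex.re_le_norm _)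
  rw [Complex.re_sum]
  have h (i : ℕ) (hi : i ∈ range n) :
      (1 / 2 : ℝ) ≤ (ZMod.stdAddChar (-(i * q * r) : ZMod M)).re := by
    have e : (-(i * q * r) : ZMod M) = ((-(i * q * r.val) : ℤ) : ZMod M) := by
      push_cast; simp
    have e2 : (2 * Real.pi * Complex.I * ((-(i * q * r.val) : ℤ) : ℂ) / M : ℂ) =
        ((-(2 * Real.pi * (i * (q * (r.val / M : ℝ) - k)) + (i * k : ℤ) * (2 * Real.pi)) : ℝ) : ℂ)
          * Complex.I := by
      push_cast; ring
    rw [e, ZMod.stdAddChar_coe, e2, Complex.exp_ofReal_mul_I_re, Real.cos_neg,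
      Real.cos_add_int_mul_two_pi]
    have hin : (8 * i : ℝ) ≤ Q := by
      have := mem_range.mp hi
      exact_mod_cast (by omega : 8 * i ≤ Q)
    have hQ' : (0 : ℝ) < Q := by exact_mod_cast hQ
    have h1 : |i * (q * (r.val / M : ℝ) - k)| ≤ 1 / 8 := by
      rw [abs_mul, Nat.abs_cast]
      calc (i : ℝ) * |q * (r.val / M : ℝ) - k| ≤ (Q / 8) * (1 / Q) := by
            gcongr; linarith
        _ = 1 / 8 := by field_simp
    refine le_trans ?_ (Real.one_sub_sq_div_two_le_cos)
    have h2 : |2 * Real.pi * (i * (q * (r.val / M : ℝ) - k))| ≤ 1 := by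
      rw [abs_mul, abs_of_pos (by positivity)]
      nlinarith [Real.pi_lt_four, Real.pi_pos]
    nlinarith [sq_le_one_iff_abs_le_one _ |>.mpr h2]
  have := card_nsmul_le_sum (range n) _ _ h
  simpa [div_eq_mul_inv] using this

end charSum

/-- Dirichlet's theorem on simultaneous approximation. -/
theorem exists_simultaneous_approx {ι : Type*} (R : Finset ι) (θ : ι → ℝ) (Q : ℕ) (hQ : 0 < Q) :
    ∃ q : ℕ, 1 ≤ q ∧ q ≤ Q ^ R.card ∧ ∀ r ∈ R, ∃ n : ℤ, |q * θ r - n| ≤ 1 / Q := by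
  classical
  have hQ' : (0 : ℝ) < Q := by exact_mod_cast hQ
  have hlt (x : ℝ) : ⌊Q * Int.fract x⌋₊ < Q := by
    rw [Nat.floor_lt (mul_nonneg hQ'.le (Int.fract_nonneg x))]
    nlinarith [Int.fract_lt_one x]
  let g : ℕ → (R → Fin Q) := fun j r => ⟨⌊Q * Int.fract (j * θ r)⌋₊, hlt _⟩
  have hcard : (univ : Finset (R → Fin Q)).card < (range (Q ^ R.card + 1)).card := by
    simp
  obtain ⟨i, hi, j, hj, hij, hg⟩ :=
    exists_ne_map_eq_of_card_lt_of_maps_to hcard (f := g) (fun _ _ => by simp)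
  wlog h : i < j generalizing i j
  · exact this j hj i hi hij.symm hg.symm (by omega)
  refine ⟨j - i, by omega, by simp at hj; omega, fun r hr => ?_⟩
  refine ⟨⌊j * θ r⌋ - ⌊i * θ r⌋, ?_⟩
  have h1 : ⌊Q * Int.fract (i * θ r)⌋₊ = ⌊Q * Int.fract (j * θ r)⌋₊ := by
    simpa [g] using congrFun hg ⟨r, hr⟩
  have hi1 := Nat.floor_le (mul_nonneg hQ'.le (Int.fract_nonneg (i * θ r)))
  have hi2 := Nat.lt_floor_add_one (Q * Int.fract (i * θ r))
  have hj1 := Nat.floor_le (mul_nonneg hQ'.le (Int.fract_nonneg (j * θ r)))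
  have hj2 := Nat.lt_floor_add_one (Q * Int.fract (j * θ r))
  rw [h1] at hi1 hi2
  have e : ((j - i : ℕ) : ℝ) * θ r - ((⌊j * θ r⌋ - ⌊i * θ r⌋ : ℤ) : ℝ)
      = Int.fract (j * θ r) - Int.fract (i * θ r) := by
    rw [Nat.cast_sub h.le]
    simp only [Int.fract]
    push_cast
    ring
  rw [e, abs_le, ← neg_div, div_le_iff₀ hQ', le_div_iff₀ hQ']
  constructor <;> linarith

theorem exists_large_sum_sq_of_sum_cube_fin {κ K : ℝ} (hκ : 0 < κ) (hK : 0 < K) :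
    ∃ c : ℝ, 0 < c ∧ ∀ (n : ℕ) (w : Fin n → ℝ) (α : ℝ), (∀ i, 0 ≤ w i) → 0 < α → α ≤ 1 →
      ∑ i, w i ^ 2 ≤ K / α → κ ≤ ∑ i, w i ^ 3 →
      ∃ (m : ℕ) (R : Finset (Fin n)), 1 ≤ m ∧ (m : ℝ) ≤ α⁻¹ ^ 9 ∧ R.card ≤ m ∧
        c * (m : ℝ) ^ (1 / 9 : ℝ) ≤ ∑ i ∈ R, w i ^ 2 := by
  have hs : Summable fun k : ℕ => ((k + 1 : ℕ) : ℝ) ^ (-4 / 3 : ℝ) :=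
    (summable_nat_add_iff 1).mpr (Real.summable_nat_rpow.mpr (by norm_num))
  set S := ∑' k : ℕ, ((k + 1 : ℕ) : ℝ) ^ (-4 / 3 : ℝ) with hS
  have hS0 : 0 ≤ S := tsum_nonneg fun _ => by positivity
  obtain ⟨b, hb0, hb1, hb⟩ : ∃ b : ℝ, 0 < b ∧ b ≤ 1 ∧ b * (S + 2 * K) < κ := by
    refine ⟨min 1 (κ / (S + 2 * K + 1)), by positivity, min_le_left _ _, ?_⟩
    have h1 : 0 < min 1 (κ / (S + 2 * K + 1)) := by positivity
    have h2 : min 1 (κ / (S + 2 * K + 1)) * (S + 2 * K + 1) ≤ κ := by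
      rw [← le_div_iff₀ (by positivity)]; exact min_le_right _ _
    linarith
  refine ⟨b ^ 2, by positivity, fun n w α hw hα hα1 hsq hcube => ?_⟩
  by_contra! hcon
  set σ := Tuple.sort fun i => -w i
  have hanti : Antitone fun i => w (σ i) := fun i j hij => by
    have := Tuple.monotone_sort (fun i => -w i) hij
    simpa using this
  have hα9 : 1 ≤ α⁻¹ ^ 9 := one_le_pow₀ ((one_le_inv₀ hα).mpr hα1)
  have small (k : Fin n) (hk : ((k + 1 : ℕ) : ℝ) ≤ α⁻¹ ^ 9) :
      w (σ k) ≤ b * ((k + 1 : ℕ) : ℝ) ^ (-4 / 9 : ℝ) := by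
    have h1 := hcon (k + 1) ((Iic k).map σ.toEmbedding) (by omega) hk (by simp)
    rw [sum_map] at h1
    have h2 : ((k + 1 : ℕ) : ℝ) * w (σ k) ^ 2 ≤ ∑ i ∈ Iic k, w (σ i) ^ 2 := by
      have := card_nsmul_le_sum (Iic k) (fun i => w (σ i) ^ 2) (w (σ k) ^ 2) fun i hi => by
        have := hanti (mem_Iic.mp hi)
        exact pow_le_pow_left₀ (hw _) this 2
      simpa using this
    have h3 := h2.trans_lt h1
    have hp : (0 : ℝ) < ((k + 1 : ℕ) : ℝ) := by positivity
    refine le_of_sq_le_sq ?_ (by positivity)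
    rw [mul_pow, ← Real.rpow_natCast (_ ^ (_ : ℝ)), ← Real.rpow_mul hp.le]
    have h4 : ((k + 1 : ℕ) : ℝ) ^ (1 / 9 : ℝ) =
        ((k + 1 : ℕ) : ℝ) * ((k + 1 : ℕ) : ℝ) ^ (-4 / 9 * (2 : ℕ) : ℝ) := by
      nth_rw 2 [← Real.rpow_one ((k + 1 : ℕ) : ℝ)]
      rw [← Real.rpow_add hp]; norm_num
    rw [h4] at h3
    nlinarith
  have term (k : Fin n) : w (σ k) ^ 3 ≤
      b * ((k + 1 : ℕ) : ℝ) ^ (-4 / 3 : ℝ) + 2 * b * α * w (σ k) ^ 2 := by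
    have hwk := hw (σ k)
    by_cases hk : ((k + 1 : ℕ) : ℝ) ≤ α⁻¹ ^ 9
    · have h1 := pow_le_pow_left₀ hwk (small k hk) 3
      rw [mul_pow, ← Real.rpow_natCast (_ ^ (_ : ℝ)), ← Real.rpow_mul (by positivity)] at h1
      norm_num at h1 ⊢
      have hb3 : b ^ 3 ≤ b := pow_le_of_le_one hb0.le hb1 (by norm_num)
      have : 0 ≤ ((k : ℝ) + 1) ^ (-(4 / 3) : ℝ) := by positivity
      have : 0 ≤ 2 * b * α * w (σ k) ^ 2 := by positivity
      nlinarith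
    · have hm1 : 1 ≤ ⌊α⁻¹ ^ 9⌋₊ := (Nat.one_le_floor_iff _).mpr hα9
      have hm2 := Nat.floor_le (zero_le_one.trans hα9)
      have hm3 := Nat.lt_floor_add_one (α⁻¹ ^ 9)
      set m := ⌊α⁻¹ ^ 9⌋₊
      have hmk : m ≤ k := by
        by_contra! h
        exact hk (le_trans (by exact_mod_cast h) hm2)
      have h1 := small ⟨m - 1, by omega⟩ (by simpa [Nat.sub_add_cancel hm1] using hm2)
      simp only [Nat.sub_add_cancel hm1] at h1
      have h2 : w (σ k) ≤ w (σ ⟨m - 1, by omega⟩) := hanti (by simp [Fin.le_def]; omega)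
      have h3 : (m : ℝ) ^ (-4 / 9 : ℝ) ≤ 2 * α := by
        have hm1' : (1 : ℝ) ≤ m := by exact_mod_cast hm1
        have h4 : α⁻¹ ^ 9 / 2 ≤ m := by linarith
        calc (m : ℝ) ^ (-4 / 9 : ℝ) ≤ (α⁻¹ ^ 9 / 2) ^ (-4 / 9 : ℝ) :=
              Real.rpow_le_rpow_of_nonpos (by positivity) h4 (by norm_num)
          _ = α ^ 4 * 2 ^ (4 / 9 : ℝ) := by
              rw [Real.div_rpow (by positivity) (by norm_num), ← Real.rpow_natCast,
                ← Real.rpow_mul (by positivity), Real.inv_rpow hα.le, ← Real.rpow_neg hα.le,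
                div_eq_mul_inv, ← Real.rpow_neg (by norm_num)]
              norm_num
          _ ≤ α * 2 := by
              gcongr
              · exact pow_le_of_le_one hα.le hα1 (by norm_num)
              · exact Real.rpow_le_self_of_one_le (by norm_num) (by norm_num)
          _ = 2 * α := by ring
      have h4 : w (σ k) ≤ 2 * b * α := by nlinarith
      have h5 : 0 ≤ b * ((k + 1 : ℕ) : ℝ) ^ (-4 / 3 : ℝ) := by positivity
      nlinarith [mul_le_mul_of_nonneg_left h4 (sq_nonneg (w (σ k)))]
  have h1 : ∑ i, w i ^ 3 ≤ b * S + 2 * b * α * (K / α) := by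
    rw [← Equiv.sum_comp σ fun i => w i ^ 3]
    refine (sum_le_sum fun k _ => term k).trans ?_
    rw [sum_add_distrib, ← mul_sum, ← mul_sum, Equiv.sum_comp σ fun i => w i ^ 2,
      Fin.sum_univ_eq_sum_range fun k => ((k + 1 : ℕ) : ℝ) ^ (-4 / 3 : ℝ)]
    gcongr
    exact hs.sum_le_tsum _ fun _ _ => by positivity
  have h2 : 2 * b * α * (K / α) = 2 * b * K := by field_simp
  linarith

/-- If the cubes of `w` have large sum, some `m` of the values carry `ℓ²` mass `≫ m ^ (1 / 9)`. -/
theorem exists_large_sum_sq_of_sum_cube {κ K : ℝ} (hκ : 0 < κ) (hK : 0 < K) :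
    ∃ c : ℝ, 0 < c ∧ ∀ (ι : Type) [Fintype ι] (w : ι → ℝ) (α : ℝ), (∀ i, 0 ≤ w i) → 0 < α →
      α ≤ 1 → ∑ i, w i ^ 2 ≤ K / α → κ ≤ ∑ i, w i ^ 3 →
      ∃ (m : ℕ) (R : Finset ι), 1 ≤ m ∧ (m : ℝ) ≤ α⁻¹ ^ 9 ∧ R.card ≤ m ∧
        c * (m : ℝ) ^ (1 / 9 : ℝ) ≤ ∑ i ∈ R, w i ^ 2 := by
  obtain ⟨c, hc, h⟩ := exists_large_sum_sq_of_sum_cube_fin hκ hK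
  refine ⟨c, hc, fun ι _ w α hw hα hα1 h2 h3 => ?_⟩
  let e := (Fintype.equivFin ι).symm
  rw [← e.sum_comp] at h2 h3
  obtain ⟨m, R, hm, hm', hR, hs⟩ := h _ (fun i => w (e i)) α (fun i => hw _) hα hα1 h2 h3
  exact ⟨m, R.map e.toEmbedding, hm, hm', by simpa using hR, by simpa using hs⟩

theorem cubic_perturbation_bound {u u' v v' : ℝ} (hu : 0 ≤ u) (hu' : 0 ≤ u') (hv : 0 ≤ v)
    (hv' : 0 ≤ v') :
    u ^ 2 * u' + 2 * u * v * u' + v ^ 2 * u' + u ^ 2 * v' + 2 * u * v * v' ≤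
      200000 * (u ^ 3 + u' ^ 3) + 1 / 64 * (v ^ 3 + v' ^ 3) := by
  obtain ⟨s, hs0, hs, hs', hs3⟩ : ∃ s, 0 ≤ s ∧ u ≤ s ∧ u' ≤ s ∧ s ^ 3 ≤ u ^ 3 + u' ^ 3 := by
    rcases le_total u u' with h | h
    · exact ⟨u', hu', h, le_rfl, by have := pow_nonneg hu 3; linarith⟩
    · exact ⟨u, hu, le_rfl, h, by have := pow_nonneg hu' 3; linarith⟩
  obtain ⟨t, ht0, ht, ht', ht3⟩ : ∃ t, 0 ≤ t ∧ v ≤ t ∧ v' ≤ t ∧ t ^ 3 ≤ v ^ 3 + v' ^ 3 := by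
    rcases le_total v v' with h | h
    · exact ⟨v', hv', h, le_rfl, by have := pow_nonneg hv 3; linarith⟩
    · exact ⟨v, hv, le_rfl, h, by have := pow_nonneg hv' 3; linarith⟩
  calc u ^ 2 * u' + 2 * u * v * u' + v ^ 2 * u' + u ^ 2 * v' + 2 * u * v * v'
      ≤ s ^ 2 * s + 2 * s * t * s + t ^ 2 * s + s ^ 2 * t + 2 * s * t * t := by gcongr
    _ = s ^ 3 + 3 * s ^ 2 * t + 3 * s * t ^ 2 := by ring
    _ ≤ 200000 * s ^ 3 + 1 / 64 * t ^ 3 := by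
        rcases le_total t (256 * s) with h | h
        · have h1 : s ^ 2 * t ≤ s ^ 2 * (256 * s) := by gcongr
          have h2 : s * t ^ 2 ≤ s * (256 * s) ^ 2 := by gcongr
          have h3 : 0 ≤ s ^ 3 := by positivity
          have h4 : 0 ≤ t ^ 3 := by positivity
          nlinarith
        · have h' : s ≤ t / 256 := by linarith
          have h1 : s ^ 2 * t ≤ (t / 256) ^ 2 * t := by gcongr
          have h2 : s * t ^ 2 ≤ t / 256 * t ^ 2 := by gcongr
          have h3 : 0 ≤ s ^ 3 := by positivity
          have h4 : s ^ 3 ≤ (t / 256) ^ 3 := by gcongr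
          have h5 : 0 ≤ t ^ 3 := by positivity
          nlinarith
    _ ≤ _ := by gcongr

/-- The indicator function of a finite set, with real values. -/
noncomputable def ind {M : ℕ} (S : Finset (ZMod M)) (z : ZMod M) : ℝ := if z ∈ S then 1 else 0

theorem ind_nonneg {M : ℕ} (S : Finset (ZMod M)) (z : ZMod M) : 0 ≤ ind S z := by
  unfold ind; split_ifs <;> norm_num

theorem ind_sq {M : ℕ} (S : Finset (ZMod M)) (z : ZMod M) : ind S z ^ 2 = ind S z := by
  unfold ind; split_ifs <;> norm_num

/-- The balanced function of `A` relative to `I`, with density `α`. -/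
noncomputable def balanced {M : ℕ} (A I : Finset (ZMod M)) (α : ℝ) (z : ZMod M) : ℝ :=
  ind A z - α * ind I z

section balanced

variable {M : ℕ} [NeZero M]

theorem sum_ind (S : Finset (ZMod M)) : ∑ z, ind S z = S.card := by
  simp [ind]

theorem tripleSum_const_mul (a : ℝ) (F : ZMod M → ℝ) :
    tripleSum (fun z => a * F z) = a ^ 3 * tripleSum F := by
  simp only [tripleSum, mul_sum]
  refine sum_congr rfl fun x _ => sum_congr rfl fun y _ => sum_congr rfl fun z _ => ?_
  split_ifs <;> ring

theorem tripleSum_ind_le {S : Finset (ZMod M)}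
    (hS : ∀ x ∈ S, ∀ y ∈ S, ∀ z ∈ S, x + y = 2 * z → x = z ∧ y = z) :
    tripleSum (ind S) ≤ S.card := by
  have h : tripleSum (ind S) ≤
      ∑ x, ∑ y, ∑ z, if x = z then (if y = z then ind S z else 0) else 0 := by
    refine sum_le_sum fun x _ => sum_le_sum fun y _ => sum_le_sum fun z _ => ?_
    by_cases h : x ∈ S ∧ y ∈ S ∧ z ∈ S ∧ x + y = 2 * z
    · obtain ⟨hx, hy, hz, e⟩ := h
      obtain ⟨rfl, rfl⟩ := hS x hx y hy z hz e
      simp [ind, hx, e]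
    · refine le_trans (le_of_eq ?_) (?_ : (0 : ℝ) ≤ _)
      · split_ifs with e
        · simp only [ind, mul_ite, mul_one, mul_zero]
          split_ifs <;> simp_all
        · rfl
      · have := ind_nonneg S z
        split_ifs <;> first | assumption | rfl
  refine h.trans_eq ?_
  rw [← sum_ind]
  simp

theorem sum_balanced_sq {A I : Finset (ZMod M)} (hAI : A ⊆ I) {α : ℝ}
    (hα : (A.card : ℝ) = α * I.card) :
    ∑ z, balanced A I α z ^ 2 = α * (1 - α) * I.card := by
  have h (z : ZMod M) : balanced A I α z ^ 2 = ind A z - 2 * α * ind A z + α ^ 2 * ind I z := by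
    have : ind A z * ind I z = ind A z := by
      by_cases hz : z ∈ A
      · simp [ind, hz, hAI hz]
      · simp [ind, hz]
    rw [balanced, sub_sq, mul_pow, ind_sq, ind_sq]
    linear_combination (-2 * α) * this
  simp_rw [h]
  rw [sum_add_distrib, sum_sub_distrib, ← mul_sum, ← mul_sum, sum_ind, sum_ind, hα]
  ring

theorem sum_norm_charSum_ind_cube_le (S : Finset (ZMod M)) :
    ∑ r, ‖charSum (ind S) r‖ ^ 3 ≤ M * (S.card : ℝ) ^ 2 := by
  have h (r : ZMod M) : ‖charSum (ind S) r‖ ≤ S.card := by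
    refine (norm_charSum_le _ r).trans_eq ?_
    simp_rw [abs_of_nonneg (ind_nonneg S _), sum_ind]
  calc ∑ r, ‖charSum (ind S) r‖ ^ 3 ≤ ∑ r, S.card * ‖charSum (ind S) r‖ ^ 2 := by
        refine sum_le_sum fun r _ => ?_
        nlinarith [h r, sq_nonneg ‖charSum (ind S) r‖]
    _ = M * (S.card : ℝ) ^ 2 := by
        rw [← mul_sum, sum_norm_charSum_sq]
        simp_rw [ind_sq, sum_ind]
        ring

theorem sum_comp_neg_two_mul (hM : Odd M) (g : ZMod M → ℝ) : ∑ r, g (-2 * r) = ∑ r, g r := by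
  have hu : IsUnit (-2 : ZMod M) := by
    have : IsUnit ((2 : ℕ) : ZMod M) :=
      (ZMod.isUnit_iff_coprime 2 M).mpr (Nat.coprime_two_left.mpr hM)
    simpa using this.neg
  exact Function.Bijective.sum_comp (IsUnit.isUnit_iff_mulLeft_bijective.mp hu) g

theorem le_sum_norm_charSum_balanced_cube (hM : Odd M) {A I : Finset (ZMod M)}
    {α : ℝ} (hα0 : 0 ≤ α) (hα : (A.card : ℝ) = α * I.card) (hI8 : 8 ≤ α ^ 2 * I.card)
    (hA : ∀ x ∈ A, ∀ y ∈ A, ∀ z ∈ A, x + y = 2 * z → x = z ∧ y = z)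
    (hI : (I.card : ℝ) ^ 2 / 2 ≤ tripleSum (ind I)) :
    M * α ^ 3 * (I.card : ℝ) ^ 2 / 1600000 ≤ ∑ r, ‖charSum (balanced A I α) r‖ ^ 3 := by
  set n : ℝ := (I.card : ℝ) with hn
  set U := charSum (balanced A I α)
  set V := charSum fun z => α * ind I z
  have hV : ∑ r, ‖V r‖ ^ 3 ≤ α ^ 3 * (M * n ^ 2) := by
    have (r : ZMod M) : ‖V r‖ ^ 3 = α ^ 3 * ‖charSum (ind I) r‖ ^ 3 := by
      simp only [V, charSum_const_mul, norm_mul, mul_pow, Complex.norm_real, Real.norm_eq_abs,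
        abs_of_nonneg hα0]
    simp_rw [this]
    rw [← mul_sum]
    gcongr
    exact sum_norm_charSum_ind_cube_le I
  have hUV (r : ZMod M) : charSum (ind A) r = U r + V r := by
    rw [← charSum_add]
    congr 1
    ext z
    simp [balanced]
  have h1 : |M * tripleSum (ind A) - M * tripleSum fun z => α * ind I z| ≤
      ∑ r, (200000 * (‖U r‖ ^ 3 + ‖U (-2 * r)‖ ^ 3) +
        1 / 64 * (‖V r‖ ^ 3 + ‖V (-2 * r)‖ ^ 3)) := by
    rw [← Real.norm_eq_abs, ← Complex.norm_real, Complex.ofReal_sub, ← sum_charSum_mul_mul,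
      ← sum_charSum_mul_mul, ← sum_sub_distrib]
    refine norm_sum_le_of_le _ fun r _ => ?_
    refine le_trans ?_ (cubic_perturbation_bound (norm_nonneg _) (norm_nonneg _) (norm_nonneg _)
      (norm_nonneg _))
    rw [hUV, hUV]
    change ‖_ - V r * V r * V (-2 * r)‖ ≤ _
    calc _ = ‖U r ^ 2 * U (-2 * r) + 2 * U r * V r * U (-2 * r) + V r ^ 2 * U (-2 * r) +
          U r ^ 2 * V (-2 * r) + 2 * U r * V r * V (-2 * r)‖ := by congr 1; ring
      _ ≤ _ := by
        refine (norm_add_le _ _).trans (add_le_add ((norm_add_le _ _).trans (add_le_add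
          ((norm_add_le _ _).trans (add_le_add ((norm_add_le _ _).trans (add_le_add ?_ ?_)) ?_))
          ?_)) ?_) <;> simp
  rw [sum_add_distrib, ← mul_sum, ← mul_sum, sum_add_distrib, sum_add_distrib,
    sum_comp_neg_two_mul hM fun r => ‖U r‖ ^ 3, sum_comp_neg_two_mul hM fun r => ‖V r‖ ^ 3,
    tripleSum_const_mul] at h1
  have h2 := (neg_le_abs _).trans h1
  have h3 : (M : ℝ) * tripleSum (ind A) ≤ M * (α ^ 3 * n ^ 2 / 8) := by
    gcongr
    refine (tripleSum_ind_le hA).trans ?_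
    rw [hα]
    have : 0 ≤ α * n := by positivity
    nlinarith
  have h4 : (M : ℝ) * (α ^ 3 * (n ^ 2 / 2)) ≤ M * (α ^ 3 * tripleSum (ind I)) := by gcongr
  have h5 : 0 ≤ α ^ 3 * (M * n ^ 2) := by positivity
  linarith

end balanced

/-- The number of `i < n` with `x + i q ∈ S`, as a real number. -/
noncomputable def progCount {M : ℕ} (S : Finset (ZMod M)) (n : ℕ) (q x : ZMod M) : ℝ :=
  ∑ i ∈ range n, ind S (x + (i : ZMod M) * q)

theorem progCount_nonneg {M : ℕ} (S : Finset (ZMod M)) (n : ℕ) (q x : ZMod M) : 0 ≤ progCount S n q x :=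
  sum_nonneg fun _ _ => ind_nonneg _ _

theorem sum_balanced_shift {M : ℕ} (A I : Finset (ZMod M)) (α : ℝ) (n : ℕ) (q x : ZMod M) :
    ∑ i ∈ range n, balanced A I α (x + (i : ZMod M) * q) =
      progCount A n q x - α * progCount I n q x := by
  simp [balanced, progCount, sum_sub_distrib, mul_sum]

theorem progCount_le {M : ℕ} (S : Finset (ZMod M)) (n : ℕ) (q x : ZMod M) : progCount S n q x ≤ n := by
  have := sum_le_card_nsmul (range n) (fun i : ℕ => ind S (x + (i : ZMod M) * q)) 1 fun i _ => by
    unfold ind; split_ifs <;> norm_num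
  simpa [progCount] using this

section energy

variable {M : ℕ} [NeZero M]

theorem sum_progCount (S : Finset (ZMod M)) (n : ℕ) (q : ZMod M) :
    ∑ x, progCount S n q x = n * S.card := by
  unfold progCount
  rw [sum_comm]
  have (i : ℕ) : ∑ x, ind S (x + (i : ZMod M) * q) = S.card := by
    rw [← sum_ind]
    exact Equiv.sum_comp (Equiv.addRight ((i : ZMod M) * q)) (ind S)
  simp [this]

/-- Energy of the balanced function over translates of a progression on which the characters in
`R` are nearly constant. -/
theorem sum_charSum_sq_le_energy (F : ZMod M → ℝ) (R : Finset (ZMod M)) (n : ℕ) (q : ZMod M)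
    (hR : ∀ r ∈ R, (n / 2 : ℝ) ≤
      ‖∑ i ∈ range n, ZMod.stdAddChar (-((i : ZMod M) * q * r) : ZMod M)‖) :
    (n : ℝ) ^ 2 / 4 * ∑ r ∈ R, ‖charSum F r‖ ^ 2 ≤
      M * ∑ x, (∑ i ∈ range n, F (x + (i : ZMod M) * q)) ^ 2 := by
  rw [← sum_norm_charSum_sq, mul_sum]
  refine le_trans (sum_le_sum fun r hr => ?_)
    (sum_le_sum_of_subset_of_nonneg (subset_univ R) fun _ _ _ => by positivity)
  rw [charSum_sum_shift, norm_mul, mul_pow]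
  gcongr
  calc (n : ℝ) ^ 2 / 4 = (n / 2) ^ 2 := by ring
    _ ≤ _ := by gcongr; exact hR r hr

theorem energy_le_of_progCount_le {A I : Finset (ZMod M)} {α D L : ℝ} {n : ℕ} {q : ZMod M}
    (hα0 : 0 ≤ α) (hα : (A.card : ℝ) = α * I.card) (hD0 : 0 ≤ D)
    (hD : ∀ x, progCount A n q x ≤ D)
    (hL : ((univ.filter fun x => progCount A n q x ≠ 0 ∧ progCount I n q x ≠ n).card : ℝ) ≤
      2 * L) :
    ∑ x, (∑ i ∈ range n, balanced A I α (x + (i : ZMod M) * q)) ^ 2 + α ^ 2 * n ^ 2 * I.card ≤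
      α * n * D * (I.card + 4 * L) := by
  set d := progCount A n q
  set u := progCount I n q
  have hd := progCount_nonneg A n q
  have hu := progCount_nonneg I n q
  have hun := progCount_le I n q
  have h1 : ∑ x, d x ^ 2 ≤ D * (n * (α * I.card)) := by
    rw [← hα, ← sum_progCount A n q, mul_sum]
    exact sum_le_sum fun x _ => by nlinarith [hd x, hD x]
  have h2 : ∑ x, u x ^ 2 ≤ n * (n * I.card) := by
    rw [← sum_progCount I n q, mul_sum]
    exact sum_le_sum fun x _ => by nlinarith [hu x, hun x]
  have h3 : ∑ x, d x * (n - u x) ≤ 2 * L * (D * n) := by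
    calc ∑ x, d x * (n - u x)
        = ∑ x with d x ≠ 0 ∧ u x ≠ n, d x * (n - u x) := by
          rw [sum_filter]
          refine sum_congr rfl fun x _ => ?_
          split_ifs with h
          · rfl
          · by_cases h0 : d x = 0
            · simp [h0]
            · have : u x = n := by by_contra h'; exact h ⟨h0, h'⟩
              simp [this]
      _ ≤ (univ.filter fun x => d x ≠ 0 ∧ u x ≠ n).card • (D * n) :=
          sum_le_card_nsmul _ _ _ fun x _ =>
            mul_le_mul (hD x) (by linarith [hu x]) (by linarith [hun x]) hD0
      _ ≤ _ := by
          rw [nsmul_eq_mul]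
          gcongr
  have h4 : ∑ x, d x * (n - u x) = n * (n * (α * I.card)) - ∑ x, d x * u x := by
    rw [← hα, ← sum_progCount A n q, mul_sum, ← sum_sub_distrib]
    exact sum_congr rfl fun x _ => by ring
  have h5 : ∑ x, (∑ i ∈ range n, balanced A I α (x + (i : ZMod M) * q)) ^ 2 =
      ∑ x, d x ^ 2 - 2 * α * ∑ x, d x * u x + α ^ 2 * ∑ x, u x ^ 2 := by
    rw [mul_sum, mul_sum, ← sum_sub_distrib, ← sum_add_distrib]
    refine sum_congr rfl fun x _ => ?_
    rw [sum_balanced_shift]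
    ring
  rw [h5]
  have h6 : α ^ 2 * ∑ x, u x ^ 2 ≤ α ^ 2 * (n * (n * I.card)) := by gcongr
  have h7 : 2 * α * (n * (n * (α * I.card)) - ∑ x, d x * u x) ≤ 2 * α * (2 * L * (D * n)) := by
    gcongr
    rw [← h4]
    exact h3
  nlinarith

end energy

section transfer

/-- The residues mod `2 N + 1` whose representative of least absolute value lies in `S`. -/
def residues (N : ℕ) (S : Finset ℤ) : Finset (ZMod (2 * N + 1)) :=
  univ.filter fun z => z.valMinAbs ∈ S

variable {N : ℕ}

theorem abs_valMinAbs_le (z : ZMod (2 * N + 1)) : -(N : ℤ) ≤ z.valMinAbs ∧ z.valMinAbs ≤ N := by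
  have := z.natAbs_valMinAbs_le
  omega

theorem valMinAbs_intCast_of_abs_le {x : ℤ} (h1 : -(N : ℤ) ≤ x) (h2 : x ≤ N) :
    (x : ZMod (2 * N + 1)).valMinAbs = x := by
  rw [ZMod.valMinAbs_spec]
  refine ⟨rfl, ?_, ?_⟩ <;> push_cast <;> omega

theorem intCast_mem_residues {S : Finset ℤ} (hS : S ⊆ Icc 1 (N : ℤ)) {x : ℤ}
    (h1 : -(N : ℤ) ≤ x) (h2 : x ≤ 2 * N) : (x : ZMod (2 * N + 1)) ∈ residues N S ↔ x ∈ S := by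
  simp only [residues, mem_filter, mem_univ, true_and]
  by_cases h : x ≤ N
  · rw [valMinAbs_intCast_of_abs_le h1 h]
  · have e : (x : ZMod (2 * N + 1)) = ((x - (2 * N + 1 : ℕ) : ℤ) : ZMod (2 * N + 1)) := by
      rw [Int.cast_sub, Int.cast_natCast, ZMod.natCast_self, sub_zero]
    rw [e, valMinAbs_intCast_of_abs_le (by push_cast; omega) (by push_cast; omega)]
    constructor <;> intro hx
    · have := mem_Icc.mp (hS hx)
      push_cast at this
      omega
    · have := mem_Icc.mp (hS hx)
      omega

theorem card_residues {S : Finset ℤ} (hS : S ⊆ Icc 1 (N : ℤ)) : (residues N S).card = S.card := by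
  refine card_nbij' ZMod.valMinAbs (fun x : ℤ => (x : ZMod (2 * N + 1))) ?_ ?_ ?_ ?_
  · intro z hz
    simpa [residues] using hz
  · intro x hx
    have := mem_Icc.mp (hS hx)
    exact (intCast_mem_residues hS (by omega) (by omega)).mpr hx
  · intro z _
    simp
  · intro x hx
    have := mem_Icc.mp (hS hx)
    exact valMinAbs_intCast_of_abs_le (by omega) (by omega)

theorem residues_mono {S T : Finset ℤ} (h : S ⊆ T) : residues N S ⊆ residues N T :=
  fun z hz => by
    simp only [residues, mem_filter, mem_univ, true_and] at hz ⊢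
    exact h hz

theorem residues_add_eq_two_mul {S : Finset ℤ} (hS : S ⊆ Icc 1 (N : ℤ))
    (hap : ¬ ∃ x y : ℤ, y ≠ 0 ∧ x ∈ S ∧ x + y ∈ S ∧ x + 2 * y ∈ S)
    {x y z : ZMod (2 * N + 1)} (hx : x ∈ residues N S) (hy : y ∈ residues N S)
    (hz : z ∈ residues N S) (h : x + y = 2 * z) : x = z ∧ y = z := by
  simp only [residues, mem_filter, mem_univ, true_and] at hx hy hz
  have hx' := mem_Icc.mp (hS hx)
  have hy' := mem_Icc.mp (hS hy)
  have hz' := mem_Icc.mp (hS hz)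
  have h0 : ((x.valMinAbs + y.valMinAbs - 2 * z.valMinAbs : ℤ) : ZMod (2 * N + 1)) = 0 := by
    push_cast
    simp [h]
  have h1 : x.valMinAbs + y.valMinAbs - 2 * z.valMinAbs = 0 := by
    refine Int.eq_zero_of_abs_lt_dvd ((ZMod.intCast_zmod_eq_zero_iff_dvd _ _).mp h0) ?_
    rw [abs_lt]
    push_cast
    constructor <;> omega
  have h2 : z.valMinAbs - x.valMinAbs = 0 := by
    by_contra h2
    refine hap ⟨x.valMinAbs, z.valMinAbs - x.valMinAbs, h2, hx, by simpa using hz, ?_⟩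
    rwa [show x.valMinAbs + 2 * (z.valMinAbs - x.valMinAbs) = y.valMinAbs by omega]
  constructor <;> rw [← ZMod.valMinAbs_inj] <;> omega

theorem le_tripleSum_residues_Icc :
    (N : ℝ) ^ 2 / 2 ≤ tripleSum (ind (residues N (Icc 1 (N : ℤ)))) := by
  set I := residues N (Icc 1 (N : ℤ)) with hI
  have hcard : (I.card : ℝ) = N := by
    rw [card_residues subset_rfl]
    simp
  let χ : ZMod (2 * N + 1) → ℝ := fun z => ind I z * (-1 : ℝ) ^ z.valMinAbs
  have key (x y : ZMod (2 * N + 1)) : (ind I x * ind I y + χ x * χ y) / 2 ≤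
      ∑ z, if x + y = 2 * z then ind I x * ind I y * ind I z else 0 := by
    have h0 (z) : 0 ≤ if x + y = 2 * z then ind I x * ind I y * ind I z else 0 := by
      have h1 := ind_nonneg I x
      have h2 := ind_nonneg I y
      have h3 := ind_nonneg I z
      split_ifs <;> positivity
    by_cases hxy : x ∈ I ∧ y ∈ I
    · obtain ⟨hx, hy⟩ := hxy
      have hx' := hx
      have hy' := hy
      simp only [hI, residues, mem_filter, mem_univ, true_and, mem_Icc] at hx' hy'
      have e : χ x * χ y = (-1 : ℝ) ^ (x.valMinAbs + y.valMinAbs) := by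
        rw [zpow_add₀ (by norm_num)]
        simp [χ, ind, hx, hy]
      rw [e]
      rcases Int.even_or_odd (x.valMinAbs + y.valMinAbs) with h | h
      · obtain ⟨c, hc⟩ := h
        have hz : (c : ZMod (2 * N + 1)) ∈ I :=
          (intCast_mem_residues subset_rfl (by omega) (by omega)).mpr (mem_Icc.mpr (by omega))
        have h2 : x + y = 2 * (c : ZMod (2 * N + 1)) := by
          have := congrArg (Int.cast : ℤ → ZMod (2 * N + 1)) hc
          push_cast at this
          rw [this]; ring
        refine le_trans ?_ (single_le_sum (fun z _ => h0 z) (mem_univ (c : ZMod (2 * N + 1))))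
        rw [Even.neg_one_zpow ⟨c, hc⟩]
        simp [ind, hx, hy, hz, h2]
      · rw [Odd.neg_one_zpow h]
        refine le_trans ?_ (sum_nonneg fun z _ => h0 z)
        simp [ind, hx, hy]
    · refine le_trans (le_of_eq ?_) (sum_nonneg fun z _ => h0 z)
      rcases not_and_or.mp hxy with h | h <;> simp [χ, ind, h]
  calc (N : ℝ) ^ 2 / 2 ≤ ((∑ x, ind I x) * (∑ y, ind I y) + (∑ x, χ x) * ∑ y, χ y) / 2 := by
        rw [sum_ind, hcard]
        nlinarith [mul_self_nonneg (∑ x, χ x)]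
    _ = ∑ x, ∑ y, (ind I x * ind I y + χ x * χ y) / 2 := by
        rw [sum_mul_sum, sum_mul_sum, ← sum_add_distrib, sum_div]
        refine sum_congr rfl fun x _ => ?_
        rw [← sum_add_distrib, sum_div]
    _ ≤ _ := sum_le_sum fun x _ => sum_le_sum fun y _ => key x y

theorem progCount_residues {S : Finset ℤ} (hS : S ⊆ Icc 1 (N : ℤ)) {n q : ℕ}
    (hL : (n - 1) * q ≤ N) (x : ZMod (2 * N + 1)) :
    progCount (residues N S) n q x =
      ((range n).filter fun i : ℕ => x.valMinAbs + i * q ∈ S).card := by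
  rw [progCount, card_filter, Nat.cast_sum]
  refine sum_congr rfl fun i hi => ?_
  have hx := abs_valMinAbs_le x
  have hiq : (i : ℤ) * q ≤ N := by
    have : i * q ≤ (n - 1) * q := Nat.mul_le_mul_right _ (by have := mem_range.mp hi; omega)
    exact_mod_cast this.trans hL
  have hiq0 : (0 : ℤ) ≤ (i : ℤ) * q := by positivity
  have e : x + (i : ZMod (2 * N + 1)) * q = ((x.valMinAbs + i * q : ℤ) : ZMod (2 * N + 1)) := by
    push_cast; simp
  rw [e]
  simp only [ind, intCast_mem_residues hS (x := x.valMinAbs + i * q) (by omega) (by omega)]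
  split_ifs <;> simp

theorem card_boundary_le {S : Finset ℤ} (hS : S ⊆ Icc 1 (N : ℤ)) {n q : ℕ}
    (hL : (n - 1) * q ≤ N) :
    (univ.filter fun x => progCount (residues N S) n q x ≠ 0 ∧
      progCount (residues N (Icc 1 (N : ℤ))) n q x ≠ n).card ≤ 2 * ((n - 1) * q) := by
  set L := (n - 1) * q with hLdef
  have hsub : ((univ.filter fun x => progCount (residues N S) n q x ≠ 0 ∧
      progCount (residues N (Icc 1 (N : ℤ))) n q x ≠ n).image ZMod.valMinAbs) ⊆
      Icc (1 - L : ℤ) 0 ∪ Icc (N + 1 - L : ℤ) N := by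
    intro y hy
    obtain ⟨x, hx, rfl⟩ := mem_image.mp hy
    have hxb := abs_valMinAbs_le x
    simp only [mem_filter, mem_univ, true_and, progCount_residues hS hL,
      progCount_residues subset_rfl hL, ne_eq, Nat.cast_eq_zero, Nat.cast_inj] at hx
    obtain ⟨h1, h2⟩ := hx
    obtain ⟨i, hi⟩ := card_pos.mp (Nat.pos_of_ne_zero h1)
    have h3 : ∃ j ∈ range n, x.valMinAbs + (j : ℤ) * q ∉ Icc 1 (N : ℤ) := by
      by_contra! h
      exact h2 (by rw [filter_true_of_mem h, card_range])
    obtain ⟨j, hj, hjI⟩ := h3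
    rw [mem_filter] at hi
    have hiI := mem_Icc.mp (hS hi.2)
    have bd (k : ℕ) (hk : k ∈ range n) : 0 ≤ (k : ℤ) * q ∧ (k : ℤ) * q ≤ L := by
      refine ⟨by positivity, ?_⟩
      have : k * q ≤ (n - 1) * q := Nat.mul_le_mul_right _ (by have := mem_range.mp hk; omega)
      exact_mod_cast this
    have hbi := bd i hi.1
    have hbj := bd j hj
    simp only [mem_Icc, not_and_or, not_le, mem_union] at hjI ⊢
    omega
  rw [← card_image_of_injective _ ZMod.injective_valMinAbs]
  refine (card_le_card hsub).trans ((card_union_le _ _).trans ?_)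
  simp only [Int.card_Icc]
  omega

end transfer

/-- The part of a progression lying in `{1, …, N}` is again a progression. -/
theorem exists_progression_inter {N : ℕ} {A : Finset ℤ} (hA : A ⊆ Icc 1 (N : ℤ)) (x : ℤ)
    {n q : ℕ} (hq : 1 ≤ q)
    (hpos : 0 < ((range n).filter fun i : ℕ => x + i * q ∈ A).card) :
    ∃ (a : ℤ) (N' : ℕ), N' ≤ n ∧ ((range n).filter fun i : ℕ => x + i * q ∈ A).card ≤ N' ∧
      ((Icc (1 : ℤ) (N' : ℤ)).image fun i => a + i * q) ⊆ Icc 1 (N : ℤ) ∧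
      ((Icc (1 : ℤ) (N' : ℤ)).image fun i => a + i * q).card = N' ∧
      ((range n).filter fun i : ℕ => x + i * q ∈ A).card ≤
        (A ∩ ((Icc (1 : ℤ) (N' : ℤ)).image fun i => a + i * q)).card := by
  set K := (range n).filter fun i : ℕ => x + i * q ∈ A with hK
  have hne : K.Nonempty := card_pos.mp hpos
  have hmin := K.min'_mem hne
  have hmax := K.max'_mem hne
  have hle : ∀ i ∈ K, K.min' hne ≤ i ∧ i ≤ K.max' hne :=
    fun i hi => ⟨K.min'_le i hi, K.le_max' i hi⟩
  set i₀ := K.min' hne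
  set i₁ := K.max' hne
  have h01 := hle i₀ hmin
  rw [hK, mem_filter, mem_range] at hmin hmax
  have b0 := mem_Icc.mp (hA hmin.2)
  have b1 := mem_Icc.mp (hA hmax.2)
  have hq' : q ≠ 0 := by omega
  have hinj : Function.Injective fun i : ℤ => x + (i₀ - 1) * q + i * q := fun i j hij => by
    simpa [hq'] using hij
  have hmem : K.image (fun i : ℕ => x + (i : ℤ) * q) ⊆
      A ∩ (Icc (1 : ℤ) ((i₁ - i₀ + 1 : ℕ) : ℤ)).image fun i => x + (i₀ - 1) * q + i * q := by
    intro y hy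
    obtain ⟨i, hi, rfl⟩ := mem_image.mp hy
    have := hle i hi
    refine mem_inter.mpr ⟨(mem_filter.mp hi).2, mem_image.mpr ⟨i - i₀ + 1, ?_, by ring⟩⟩
    rw [mem_Icc]
    omega
  have hcardK : (K.image fun i : ℕ => x + (i : ℤ) * q).card = K.card :=
    card_image_of_injective _ fun i j hij => by simpa [hq'] using hij
  have hcardP : ((Icc (1 : ℤ) ((i₁ - i₀ + 1 : ℕ) : ℤ)).image
      fun i => x + (i₀ - 1) * q + i * q).card = i₁ - i₀ + 1 := by
    rw [card_image_of_injective _ hinj, Int.card_Icc]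
    omega
  have hcard := card_le_card hmem
  rw [hcardK] at hcard
  refine ⟨x + (i₀ - 1) * q, i₁ - i₀ + 1, by omega, ?_, ?_, hcardP, hcard⟩
  · exact (hcard.trans (card_le_card inter_subset_right)).trans_eq hcardP
  · intro y hy
    obtain ⟨i, hi, rfl⟩ := mem_image.mp hy
    rw [mem_Icc] at hi ⊢
    have h1 : (i₀ : ℤ) ≤ i₀ - 1 + i := by omega
    have h2 : (i₀ : ℤ) - 1 + i ≤ i₁ := by omega
    have hq0 : (0 : ℤ) ≤ q := by positivity
    have h3 := mul_le_mul_of_nonneg_right h1 hq0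
    have h4 := mul_le_mul_of_nonneg_right h2 hq0
    constructor <;> linarith

/-- A progression of length at least `X ^ (1 / (m + 1)) / 8` and diameter at most `X` on which
the at most `m` characters in `R` are nearly constant. -/
theorem exists_progression_of_characters {M : ℕ} [NeZero M] (R : Finset (ZMod M)) {m : ℕ}
    (hR : R.card ≤ m) {X : ℝ} (hX : 0 ≤ X) :
    ∃ n q : ℕ, 1 ≤ n ∧ 1 ≤ q ∧ (((n - 1) * q : ℕ) : ℝ) ≤ X ∧
      X ^ (1 / (m + 1) : ℝ) / 8 ≤ n ∧
      ∀ r ∈ R, (n / 2 : ℝ) ≤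
        ‖∑ i ∈ range n, ZMod.stdAddChar (-((i : ZMod M) * (q : ZMod M) * r) : ZMod M)‖ := by
  have hY : 0 ≤ X ^ (1 / (m + 1) : ℝ) := by positivity
  have hQ1 := Nat.floor_le hY
  have hQ2 := Nat.lt_floor_add_one (X ^ (1 / (m + 1) : ℝ))
  set Q := ⌊X ^ (1 / (m + 1) : ℝ)⌋₊
  rcases Nat.eq_zero_or_pos Q with h0 | hQ
  · refine ⟨1, 1, le_rfl, le_rfl, by simpa using hX, ?_, fun r _ => ?_⟩
    · rw [h0] at hQ2
      norm_num at hQ2 ⊢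
      linarith
    · simp
      norm_num
  obtain ⟨q, hq1, hq2, hq⟩ :=
    exists_simultaneous_approx R (fun r => (r.val / M : ℝ)) Q hQ
  refine ⟨Q / 8 + 1, q, by omega, hq1, ?_, ?_, fun r hr => ?_⟩
  · have h1 : (Q / 8 + 1 - 1) * q ≤ Q ^ (m + 1) := by
      rw [pow_succ', Nat.add_sub_cancel]
      exact Nat.mul_le_mul (Nat.div_le_self _ _) (hq2.trans (Nat.pow_le_pow_right hQ hR))
    calc (((Q / 8 + 1 - 1) * q : ℕ) : ℝ) ≤ ((Q ^ (m + 1) : ℕ) : ℝ) := by exact_mod_cast h1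
      _ = (Q : ℝ) ^ (m + 1) := by push_cast; rfl
      _ ≤ (X ^ (1 / (m + 1) : ℝ)) ^ (m + 1) := by gcongr
      _ = X := by
          rw [← Real.rpow_natCast, ← Real.rpow_mul hX]
          push_cast
          rw [one_div_mul_cancel (by positivity), Real.rpow_one]
  · have h1 : Q + 1 ≤ 8 * (Q / 8 + 1) := by omega
    have h2 : (Q + 1 : ℝ) ≤ 8 * ((Q / 8 + 1 : ℕ) : ℝ) := by exact_mod_cast h1
    linarith
  · obtain ⟨k, hk⟩ := hq r hr
    exact half_le_norm_sum_stdAddChar (by omega) hQ hk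

theorem count_lower_bound {α N n b p D E L : ℝ} (hα : 0 < α) (hN : 0 < N) (hn : 0 < n)
    (hb : 0 < b) (hb1 : b ≤ 1) (hp : 1 ≤ p) (hD : 0 ≤ D) (hL : L ≤ b / 200 * N)
    (hE : n ^ 2 * α ^ 2 * N * (b * p / 12) ≤ E)
    (hincr : E + α ^ 2 * n ^ 2 * N ≤ α * n * D * (N + 4 * L)) :
    n * α * (1 + b / 1600 * p) ≤ D := by
  have h1 : α * n * D * (N + 4 * L) ≤
      α * n * D * (N + 4 * (b / 200 * N)) := by gcongr
  have h2 : (α * n * N) * (n * α * (1 + b * p / 12)) ≤ (α * n * N) * (D * (1 + b / 50)) := by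
    linarith
  have h3 := le_of_mul_le_mul_left h2 (by positivity)
  have h4 : (1 + b / 1600 * p) * (1 + b / 50) ≤ 1 + b * p / 12 := by
    have : b ≤ b * p := le_mul_of_one_le_right hb.le hp
    have : b * p * b ≤ b * p := mul_le_of_le_one_right (by positivity) hb1
    linarith
  refine le_of_mul_le_mul_right ?_ (by positivity : (0 : ℝ) < 1 + b / 50)
  refine le_trans ?_ h3
  rw [mul_assoc (n * α : ℝ)]
  gcongr


/-- Heath-Brown–Szemerédi style density increment: there are absolute constants `c, C > 0`
such that any `A ⊆ {1,…,N}` of density `α` without nontrivial three-term arithmetic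
progressions either satisfies `N < 8/α²` (i.e. `α²·N < 8`) or has density at least
`α(1 + c·m^{1/9})` on an arithmetic progression `P = {a+q,…,a+N'q} ⊆ {1,…,N}` of length
`N' ≥ c·α·N^{1/(m+1)}`, for some `1 ≤ m ≤ C·α⁻⁹`. -/
theorem heath_brown_szemeredi_increment :
    ∃ c C : ℝ, 0 < c ∧ 0 < C ∧
      ∀ (N : ℕ) (A : Finset ℤ), A ⊆ Finset.Icc 1 (N : ℤ) →
        (¬ ∃ x y : ℤ, y ≠ 0 ∧ x ∈ A ∧ x + y ∈ A ∧ x + 2 * y ∈ A) →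
        (((A.card : ℝ) / N) ^ 2 * N < 8) ∨
          ∃ (m : ℕ) (a q : ℤ) (N' : ℕ), 1 ≤ m ∧ (m : ℝ) ≤ C * ((A.card : ℝ) / N)⁻¹ ^ 9 ∧
            1 ≤ q ∧
            c * ((A.card : ℝ) / N) * (N : ℝ) ^ (1 / (m + 1) : ℝ) ≤ (N' : ℝ) ∧
            ((Finset.Icc (1 : ℤ) (N' : ℤ)).image fun i => a + i * q) ⊆ Finset.Icc 1 (N : ℤ) ∧
            ((A ∩ ((Finset.Icc (1 : ℤ) (N' : ℤ)).image fun i => a + i * q)).card : ℝ) /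
                (((Finset.Icc (1 : ℤ) (N' : ℤ)).image fun i => a + i * q).card) ≥
              ((A.card : ℝ) / N) * (1 + c * (m : ℝ) ^ (1 / 9 : ℝ)) := by
  obtain ⟨c₁, hc₁, hsel⟩ := exists_large_sum_sq_of_sum_cube
    (κ := 1 / 1600000) (K := 3) (by norm_num) (by norm_num)
  obtain ⟨b, hb0, hb1, hbc⟩ : ∃ b : ℝ, 0 < b ∧ b ≤ 1 ∧ b ≤ c₁ :=
    ⟨min 1 c₁, by positivity, min_le_left _ _, min_le_right _ _⟩
  refine ⟨b / 1600, 1, by positivity, one_pos, fun N A hA hap => or_iff_not_imp_left.mpr ?_⟩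
  intro h8
  rw [not_lt] at h8
  set α : ℝ := (A.card : ℝ) / N with hαdef
  have hα0' : 0 ≤ α := by positivity
  have hN : (0 : ℝ) < N := by
    rcases Nat.eq_zero_or_pos N with h | h
    · rw [h] at h8; norm_num at h8
    · exact_mod_cast h
  have hα0 : 0 < α := by
    rcases hα0'.eq_or_lt with h | h
    · rw [← h] at h8; norm_num at h8
    · exact h
  have hα1 : α ≤ 1 := by
    rw [hαdef, div_le_one hN]
    exact_mod_cast (card_le_card hA).trans_eq (by simp)
  have hαN : (A.card : ℝ) = α * N := by rw [hαdef]; field_simp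
  clear_value α
  have hM : ((2 * N + 1 : ℕ) : ℝ) = 2 * N + 1 := by push_cast; rfl
  have hN1 : (1 : ℝ) ≤ N := by
    have : 0 < N := by exact_mod_cast hN
    exact_mod_cast this
  let A' := residues N A
  let I := residues N (Icc 1 (N : ℤ))
  have hIc : (I.card : ℝ) = N := by
    rw [card_residues subset_rfl]
    simp
  have hAc : (A'.card : ℝ) = α * I.card := by rw [hIc, card_residues hA, hαN]
  set U := charSum (balanced A' I α) with hU
  have hcube := le_sum_norm_charSum_balanced_cube (odd_two_mul_add_one N) hα0' hAc
    (by rw [hIc]; exact h8) (fun x hx y hy z hz => residues_add_eq_two_mul hA hap hx hy hz)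
    (by rw [hIc]; exact le_tripleSum_residues_Icc)
  have hsq := sum_norm_charSum_sq (balanced A' I α)
  rw [sum_balanced_sq (residues_mono hA) hAc] at hsq
  rw [← hU] at hcube hsq
  rw [hIc, hM] at hcube hsq
  obtain ⟨m, R, hm1, hm2, hRm, hR⟩ := hsel _ (fun r => ‖U r‖ / (α * N)) α
    (fun r => by positivity) hα0 hα1
    (by
      simp_rw [div_pow]
      rw [← sum_div, hsq, div_le_div_iff₀ (by positivity) hα0]
      have : (2 * N + 1) * (1 - α) ≤ 3 * (N : ℝ) := by nlinarith
      have : (α ^ 2 * N) * ((2 * N + 1) * (1 - α)) ≤ (α ^ 2 * N) * (3 * (N : ℝ)) := by gcongr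
      linarith)
    (by
      simp_rw [div_pow]
      rw [← sum_div, le_div_iff₀ (by positivity)]
      refine le_trans ?_ hcube
      have : 0 ≤ α ^ 3 * (N : ℝ) ^ 2 * (N + 1) := by positivity
      linarith)
  set p : ℝ := (m : ℝ) ^ (1 / 9 : ℝ) with hp
  have hp1 : 1 ≤ p := Real.one_le_rpow (by exact_mod_cast hm1) (by norm_num)
  obtain ⟨n, q, hn1, hq1, hL, hnlen, hchar⟩ :=
    exists_progression_of_characters R hRm (X := b / 200 * N) (by positivity)
  have hn0 : (0 : ℝ) < n := by exact_mod_cast hn1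
  have hLN : (n - 1) * q ≤ N := by
    have : (((n - 1) * q : ℕ) : ℝ) ≤ N := hL.trans (by nlinarith)
    exact_mod_cast this
  obtain ⟨x, -, hx⟩ := exists_max_image univ (progCount A' n (q : ZMod (2 * N + 1))) univ_nonempty
  have henergy := sum_charSum_sq_le_energy (balanced A' I α) R n (q : ZMod (2 * N + 1)) hchar
  have hincr := energy_le_of_progCount_le hα0' hAc (progCount_nonneg A' n (q : ZMod (2 * N + 1)) x)
    (fun y => hx y (mem_univ y)) (L := (((n - 1) * q : ℕ) : ℝ))
    (by exact_mod_cast card_boundary_le hA hLN)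
  set D := progCount A' n (q : ZMod (2 * N + 1)) x with hD
  set E := ∑ x, (∑ i ∈ range n,
    balanced A' I α (x + (i : ZMod (2 * N + 1)) * (q : ZMod (2 * N + 1)))) ^ 2
  have hD0 : 0 ≤ D := progCount_nonneg A' n (q : ZMod (2 * N + 1)) x
  rw [hIc] at hincr
  rw [hM] at henergy
  have hRU : b * p * (α * N) ^ 2 ≤ ∑ r ∈ R, ‖U r‖ ^ 2 := by
    simp_rw [div_pow] at hR
    rw [← sum_div, le_div_iff₀ (by positivity)] at hR
    refine le_trans ?_ hR
    gcongr
  have hE : n ^ 2 * α ^ 2 * N * (b * p / 12) ≤ E := by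
    have h1 : (n : ℝ) ^ 2 / 4 * (b * p * (α * N) ^ 2) ≤ (3 * N) * E :=
      calc _ ≤ (n : ℝ) ^ 2 / 4 * ∑ r ∈ R, ‖U r‖ ^ 2 := by gcongr
        _ ≤ (2 * N + 1) * E := henergy
        _ ≤ (3 * N) * E := by
          have : 0 ≤ E := sum_nonneg fun _ _ => sq_nonneg _
          gcongr
          linarith
    refine le_of_mul_le_mul_left ?_ (by positivity : (0 : ℝ) < 3 * N)
    linarith
  have hDlow := count_lower_bound hα0 hN hn0 hb0 hb1 hp1 hD0 hL hE hincr
  have hDα : n * α ≤ D := by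
    refine le_trans ?_ hDlow
    have : 0 ≤ n * α * (b / 1600 * p) := by positivity
    linarith
  have hDk := progCount_residues hA hLN x
  rw [← hD] at hDk
  obtain ⟨a, N', hN'n, hkN', hsub, hcard, hk⟩ := exists_progression_inter hA x.valMinAbs hq1
    (n := n) (by
      have : 0 < D := lt_of_lt_of_le (by positivity) hDα
      rw [hDk] at this
      exact_mod_cast this)
  have hDN' : D ≤ N' := by rw [hDk]; exact_mod_cast hkN'
  refine ⟨m, a, q, N', hm1, by rwa [one_mul], by exact_mod_cast hq1, ?_, hsub, ?_⟩
  · refine le_trans ?_ (hDα.trans hDN')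
    have h1 : b / 200 * (N : ℝ) ^ (1 / (m + 1) : ℝ) ≤ (b / 200 * N) ^ (1 / (m + 1) : ℝ) := by
      rw [Real.mul_rpow (by positivity) (by positivity)]
      gcongr
      refine Real.self_le_rpow_of_le_one (by positivity) (by linarith) ?_
      rw [div_le_one (by positivity)]
      have : (0 : ℝ) ≤ m := by positivity
      linarith
    have h2 : b / 1600 * (N : ℝ) ^ (1 / (m + 1) : ℝ) ≤ n := by linarith
    calc _ = b / 1600 * (N : ℝ) ^ (1 / (m + 1) : ℝ) * α := by ring
      _ ≤ n * α := by gcongr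
  · rw [hcard, ge_iff_le, le_div_iff₀ (lt_of_lt_of_le (by positivity) (hDα.trans hDN'))]
    calc α * (1 + b / 1600 * p) * N' ≤ α * (1 + b / 1600 * p) * n := by gcongr
      _ = n * α * (1 + b / 1600 * p) := by ring
      _ ≤ D := hDlow
      _ ≤ _ := by rw [hDk]; exact_mod_cast hk
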